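/- arXiv:2002.02700 — 2 statements merged into one kernel-verified Lean document; each statement's English description precedes it below -/
import Mathlib

section
/- If L is a Cameron-Liebler line class of parameter x in AG(3,q), then x(x-1)/2 ≡ 0 (mod q+1), equivalently x(x-1) ≡ 0 (mod 2(q+1)). -/
open scoped Classical

namespace CL

variable (F : Type) [Field F] [Fintype F]

/-- Points of PG(3,q): 1-dimensional subspaces of F^4. -/
def PGPoint := {W : Submodule F (Fin 4 → F) // Module.finrank F W = 1}

/-- Lines of PG(3,q): 2-dimensional subspaces of F^4. -/
def PGLine := {W : Submodule F (Fin 4 → F) // Module.finrank F W = 2}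

/-- Planes of PG(3,q): 3-dimensional subspaces of F^4. -/
def PGPlane := {W : Submodule F (Fin 4 → F) // Module.finrank F W = 3}

/-- The plane at infinity: the hyperplane of vectors with last coordinate zero. -/
def infPlane : Submodule F (Fin 4 → F) := LinearMap.ker (LinearMap.proj (3 : Fin 4))

variable {F}

/-- A line of PG(3,q) is affine (a line of AG(3,q)) if it is not contained in π_∞. -/
def affLine (ℓ : PGLine F) : Prop := ¬ ℓ.1 ≤ infPlane F

/-- A point of PG(3,q) is affine if it does not lie in π_∞. -/
def affPoint (p : PGPoint F) : Prop := ¬ p.1 ≤ infPlane F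

/-- A line spread of PG(3,q): every point lies on exactly one line of S. -/
def IsPGSpread (S : Set (PGLine F)) : Prop :=
  ∀ p : PGPoint F, ∃! ℓ, ℓ ∈ S ∧ p.1 ≤ ℓ.1

/-- A line spread of AG(3,q): a set of affine lines such that every affine point
lies on exactly one line of S (i.e. pairwise disjoint affine lines partitioning AG(3,q)). -/
def IsAGSpread (S : Set (PGLine F)) : Prop :=
  (∀ ℓ ∈ S, affLine ℓ) ∧ ∀ p : PGPoint F, affPoint p → ∃! ℓ, ℓ ∈ S ∧ p.1 ≤ ℓ.1

/-- A Cameron-Liebler line class of parameter x in PG(3,q). -/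
def IsCLPG (L : Set (PGLine F)) (x : ℕ) : Prop :=
  ∀ S : Set (PGLine F), IsPGSpread S → (L ∩ S).ncard = x

/-- A Cameron-Liebler line class of parameter x in AG(3,q). -/
def IsCLAG (L : Set (PGLine F)) (x : ℕ) : Prop :=
  (∀ ℓ ∈ L, affLine ℓ) ∧
  ∀ S : Set (PGLine F), IsAGSpread S → (L ∩ S).ncard = x

end CL

open Module

namespace CL

variable {F : Type} [Field F]

theorem finrank_infPlane : finrank F (infPlane F) = 3 := by
  have h := LinearMap.finrank_range_add_finrank_ker
    (LinearMap.proj (3 : Fin 4) : (Fin 4 → F) →ₗ[F] F)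
  rw [LinearMap.range_eq_top.mpr (LinearMap.proj_surjective _), finrank_top, finrank_self,
    finrank_fin_fun] at h
  unfold infPlane
  omega

theorem finrank_point_sup_point {p P : PGPoint F} (h : p ≠ P) : finrank F ↥(p.1 ⊔ P.1) = 2 := by
  have hs := Submodule.finrank_sup_add_finrank_inf_eq p.1 P.1
  have hp := p.2
  have hP := P.2
  have hinf : finrank F ↥(p.1 ⊓ P.1) < 1 := by
    by_contra! hge
    have hle := Submodule.finrank_mono (inf_le_left : p.1 ⊓ P.1 ≤ p.1)
    have h1 : p.1 ⊓ P.1 = p.1 := Submodule.eq_of_le_of_finrank_eq inf_le_left (by omega)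
    exact h (Subtype.ext (Submodule.eq_of_le_of_finrank_eq (inf_eq_left.mp h1) (by omega)))
  omega

/-- The line joining two distinct points. -/
def join (p P : PGPoint F) (h : p ≠ P) : PGLine F := ⟨p.1 ⊔ P.1, finrank_point_sup_point h⟩

theorem eq_join {p P : PGPoint F} (h : p ≠ P) {ℓ : PGLine F} (hp : p.1 ≤ ℓ.1) (hP : P.1 ≤ ℓ.1) :
    ℓ = join p P h :=
  Subtype.ext (Submodule.eq_of_le_of_finrank_eq (sup_le hp hP)
    ((finrank_point_sup_point h).trans ℓ.2.symm)).symm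

theorem ne_of_affPoint {p P : PGPoint F} (hp : p.1 ≤ infPlane F) (hP : affPoint P) : p ≠ P := by
  rintro rfl
  exact hP hp

theorem affLine_of_affPoint {P : PGPoint F} (hP : affPoint P) {ℓ : PGLine F} (h : P.1 ≤ ℓ.1) :
    affLine ℓ :=
  fun hℓ => hP (h.trans hℓ)

/-- The affine lines through a point at infinity form a spread of AG(3,q). -/
theorem isAGSpread_parallelClass {p : PGPoint F} (hp : p.1 ≤ infPlane F) :
    IsAGSpread {ℓ : PGLine F | affLine ℓ ∧ p.1 ≤ ℓ.1} := by
  refine ⟨fun ℓ hℓ => hℓ.1, fun P hP => ?_⟩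
  have hne := ne_of_affPoint hp hP
  exact ⟨join p P hne, ⟨⟨affLine_of_affPoint hP le_sup_right, le_sup_left⟩, le_sup_right⟩,
    fun ℓ hℓ => eq_join hne hℓ.1.2 hℓ.2⟩

/-- Replacing, inside a plane `π`, the direction `p` by another direction `p'` of `π` turns a
parallel class into another spread of AG(3,q). -/
theorem isAGSpread_switch {p p' : PGPoint F} (hp : p.1 ≤ infPlane F) (hp' : p'.1 ≤ infPlane F)
    {π : PGPlane F} (hpπ : p.1 ≤ π.1) (hpπ' : p'.1 ≤ π.1) :
    IsAGSpread ({ℓ : PGLine F | affLine ℓ ∧ p.1 ≤ ℓ.1 ∧ ¬ ℓ.1 ≤ π.1} ∪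
      {ℓ : PGLine F | affLine ℓ ∧ p'.1 ≤ ℓ.1 ∧ ℓ.1 ≤ π.1}) := by
  refine ⟨fun ℓ hℓ => hℓ.elim (·.1) (·.1), fun P hP => ?_⟩
  have hne := ne_of_affPoint hp hP
  have hne' := ne_of_affPoint hp' hP
  by_cases hPπ : P.1 ≤ π.1
  · refine ⟨join p' P hne', ⟨Or.inr ⟨affLine_of_affPoint hP le_sup_right, le_sup_left,
      sup_le hpπ' hPπ⟩, le_sup_right⟩, ?_⟩
    rintro ℓ ⟨⟨-, hℓ, hℓπ⟩ | ⟨-, hℓ, -⟩, hPℓ⟩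
    · refine absurd ?_ hℓπ
      rw [eq_join hne hℓ hPℓ]
      exact sup_le hpπ hPπ
    · exact eq_join hne' hℓ hPℓ
  · refine ⟨join p P hne, ⟨Or.inl ⟨affLine_of_affPoint hP le_sup_right, le_sup_left,
      fun h => hPπ (le_sup_right.trans h)⟩, le_sup_right⟩, ?_⟩
    rintro ℓ ⟨⟨-, hℓ, -⟩ | ⟨-, -, hℓπ⟩, hPℓ⟩
    · exact eq_join hne hℓ hPℓ
    · exact absurd (hPℓ.trans hℓπ) hPπ

theorem finrank_line_sup_line {p : PGPoint F} {ℓ m : PGLine F} (hne : ℓ ≠ m) (hℓ : p.1 ≤ ℓ.1)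
    (hm : p.1 ≤ m.1) : finrank F ↥(ℓ.1 ⊔ m.1) = 3 := by
  have hs := Submodule.finrank_sup_add_finrank_inf_eq ℓ.1 m.1
  have hp := p.2
  have hℓ2 := ℓ.2
  have hm2 := m.2
  have hge := Submodule.finrank_mono (le_inf hℓ hm)
  have hle := Submodule.finrank_mono (inf_le_left : ℓ.1 ⊓ m.1 ≤ ℓ.1)
  have hlt : finrank F ↥(ℓ.1 ⊓ m.1) ≠ 2 := fun h2 => by
    have h1 : ℓ.1 ⊓ m.1 = ℓ.1 := Submodule.eq_of_le_of_finrank_eq inf_le_left (by omega)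
    exact hne (Subtype.ext (Submodule.eq_of_le_of_finrank_eq (inf_eq_left.mp h1) (by omega)))
  omega

theorem finrank_plane_inf_infPlane {π : PGPlane F} (hπ : ¬ π.1 ≤ infPlane F) :
    finrank F ↥(infPlane F ⊓ π.1) = 2 := by
  have hs := Submodule.finrank_sup_add_finrank_inf_eq (infPlane F) π.1
  have hlt := Submodule.finrank_lt_finrank_of_lt (left_lt_sup.mpr hπ)
  have hle := Submodule.finrank_le (infPlane F ⊔ π.1)
  rw [finrank_fin_fun] at hle
  have hH := finrank_infPlane (F := F)
  have h3 := π.2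
  omega

variable [Fintype F]

instance : Finite (PGPoint F) := Subtype.finite
instance : Finite (PGLine F) := Subtype.finite
instance : Finite (PGPlane F) := Subtype.finite
noncomputable instance : Fintype (PGPoint F) := Fintype.ofFinite _
noncomputable instance : Fintype (PGLine F) := Fintype.ofFinite _
noncomputable instance : Fintype (PGPlane F) := Fintype.ofFinite _

/-- The lines of `L` through `p`. -/
noncomputable def star (L : Set (PGLine F)) (p : PGPoint F) : Finset (PGLine F) :=
  {ℓ | ℓ ∈ L ∧ p.1 ≤ ℓ.1}

/-- The lines of `L` through `p` in the plane `π`. -/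
noncomputable def pencil (L : Set (PGLine F)) (p : PGPoint F) (π : PGPlane F) :
    Finset (PGLine F) :=
  {ℓ | ℓ ∈ L ∧ p.1 ≤ ℓ.1 ∧ ℓ.1 ≤ π.1}

theorem IsCLAG.card_star {L : Set (PGLine F)} {x : ℕ} (h : IsCLAG L x) {p : PGPoint F}
    (hp : p.1 ≤ infPlane F) : (star L p).card = x := by
  rw [← h.2 _ (isAGSpread_parallelClass hp), ← Set.ncard_coe_finset]
  congr 1
  ext ℓ
  have := h.1 ℓ
  simp [star]
  tauto

theorem IsCLAG.card_pencil {L : Set (PGLine F)} {x : ℕ} (h : IsCLAG L x) {p p' : PGPoint F}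
    (hp : p.1 ≤ infPlane F) (hp' : p'.1 ≤ infPlane F) {π : PGPlane F} (hpπ : p.1 ≤ π.1)
    (hpπ' : p'.1 ≤ π.1) : (pencil L p π).card = (pencil L p' π).card := by
  set R : Finset (PGLine F) := {ℓ | ℓ ∈ L ∧ p.1 ≤ ℓ.1 ∧ ¬ ℓ.1 ≤ π.1} with hR
  have h₁ : (R ∪ pencil L p π).card = x := by
    rw [← h.card_star hp]
    congr 1
    ext ℓ
    simp [hR, star, pencil]
    tauto
  have h₂ : (R ∪ pencil L p' π).card = x := by
    rw [← h.2 _ (isAGSpread_switch hp hp' hpπ hpπ'), ← Set.ncard_coe_finset]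
    congr 1
    ext ℓ
    have := h.1 ℓ
    simp [hR, pencil]
    tauto
  have hdisj : ∀ r, Disjoint R (pencil L r π) := fun r => by
    rw [Finset.disjoint_left]
    intro ℓ hℓ hℓ'
    simp only [hR, pencil, Finset.mem_filter] at hℓ hℓ'
    exact hℓ.2.2.2 hℓ'.2.2.2
  rw [Finset.card_union_of_disjoint (hdisj _)] at h₁ h₂
  omega

theorem card_offDiag_star {L : Set (PGLine F)} (hL : ∀ ℓ ∈ L, affLine ℓ) (p : PGPoint F) :
    (star L p).offDiag.card = ∑ π : PGPlane F with ¬ π.1 ≤ infPlane F ∧ p.1 ≤ π.1,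
      (pencil L p π).offDiag.card := by
  have hcover : (star L p).offDiag =
      (Finset.univ.filter fun π : PGPlane F => ¬ π.1 ≤ infPlane F ∧ p.1 ≤ π.1).biUnion
        fun π => (pencil L p π).offDiag := by
    ext ⟨ℓ, m⟩
    simp only [Finset.mem_offDiag, star, pencil, Finset.mem_filter, Finset.mem_univ, true_and,
      Finset.mem_biUnion]
    constructor
    · rintro ⟨⟨hℓ, hpℓ⟩, ⟨hm, hpm⟩, hne⟩
      exact ⟨⟨ℓ.1 ⊔ m.1, finrank_line_sup_line hne hpℓ hpm⟩,
        ⟨fun hle => hL ℓ hℓ (le_sup_left.trans hle), hpℓ.trans le_sup_left⟩,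
        ⟨hℓ, hpℓ, le_sup_left⟩, ⟨hm, hpm, le_sup_right⟩, hne⟩
    · rintro ⟨π, -, ⟨hℓ, hpℓ, -⟩, ⟨hm, hpm, -⟩, hne⟩
      exact ⟨⟨hℓ, hpℓ⟩, ⟨hm, hpm⟩, hne⟩
  rw [hcover, Finset.card_biUnion]
  intro π _ ρ _ hπρ
  rw [Function.onFun, Finset.disjoint_left]
  rintro ⟨ℓ, m⟩ h₁ h₂
  simp only [Finset.mem_offDiag, pencil, Finset.mem_filter, Finset.mem_univ, true_and] at h₁ h₂
  have hr := finrank_line_sup_line h₁.2.2 h₁.1.2.1 h₁.2.1.2.1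
  refine hπρ (Subtype.ext ?_)
  rw [← Submodule.eq_of_le_of_finrank_eq (sup_le h₁.1.2.2 h₁.2.1.2.2) (hr.trans π.2.symm),
    Submodule.eq_of_le_of_finrank_eq (sup_le h₂.1.2.2 h₂.2.1.2.2) (hr.trans ρ.2.symm)]

theorem card_points_le (W : Submodule F (Fin 4 → F)) :
    (Finset.univ.filter fun p : PGPoint F => p.1 ≤ W).card =
      ∑ i ∈ Finset.range (finrank F W), Fintype.card F ^ i := by
  have e : {p : PGPoint F // p.1 ≤ W} ≃ {U : Submodule F W // finrank F U = 1} :=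
    { toFun := fun p => ⟨p.1.1.comap W.subtype,
        (Submodule.comapSubtypeEquivOfLe p.2).finrank_eq.trans p.1.2⟩
      invFun := fun U => ⟨⟨U.1.map W.subtype,
        (Submodule.finrank_map_subtype_eq W U.1).trans U.2⟩, Submodule.map_subtype_le W U.1⟩
      left_inv := fun p => Subtype.ext (Subtype.ext
        ((Submodule.map_comap_subtype _ _).trans (inf_eq_right.mpr p.2)))
      right_inv := fun U => Subtype.ext
        (Submodule.comap_map_eq_of_injective W.injective_subtype U.1) }
  rw [← Fintype.card_subtype, ← Nat.card_eq_fintype_card, Nat.card_congr e,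
    ← Nat.card_congr (Projectivization.equivSubmodule F W), Projectivization.card_of_finrank F W rfl,
    Nat.card_eq_fintype_card]

theorem two_dvd_card_offDiag {α : Type*} (s : Finset α) : 2 ∣ s.offDiag.card := by
  rw [Finset.offDiag_card, ← Nat.mul_sub_one]
  exact (Nat.even_mul_pred_self _).two_dvd

theorem IsCLAG.dvd_sum_card_offDiag_pencil {L : Set (PGLine F)} {x : ℕ} (h : IsCLAG L x)
    {π : PGPlane F} (hπ : ¬ π.1 ≤ infPlane F) :
    2 * (Fintype.card F + 1) ∣ ∑ p : PGPoint F with p.1 ≤ infPlane F ⊓ π.1,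
      (pencil L p π).offDiag.card := by
  have hcard := card_points_le (infPlane F ⊓ π.1)
  rw [finrank_plane_inf_infPlane hπ] at hcard
  simp only [Finset.sum_range_succ, Finset.sum_range_zero, pow_zero, pow_one, zero_add] at hcard
  obtain ⟨r, hr⟩ := Finset.card_pos.mp (by rw [hcard]; omega : 0 < Finset.card _)
  simp only [Finset.mem_filter, Finset.mem_univ, true_and, le_inf_iff] at hr
  have hconst : ∀ p ∈ Finset.univ.filter (fun p : PGPoint F => p.1 ≤ infPlane F ⊓ π.1),
      (pencil L p π).offDiag.card = (pencil L r π).offDiag.card := by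
    intro p hp
    simp only [Finset.mem_filter, Finset.mem_univ, true_and, le_inf_iff] at hp
    rw [Finset.offDiag_card, Finset.offDiag_card, h.card_pencil hp.1 hr.1 hp.2 hr.2]
  rw [Finset.sum_congr rfl hconst, Finset.sum_const, hcard, smul_eq_mul, mul_comm 2, add_comm]
  exact Nat.mul_dvd_mul_left _ (two_dvd_card_offDiag _)

theorem IsCLAG.dvd_mul_pred {L : Set (PGLine F)} {x : ℕ} (h : IsCLAG L x) :
    2 * (Fintype.card F + 1) ∣ x * (x - 1) := by
  have hcount : (Fintype.card F ^ 2 + Fintype.card F + 1) * (x * (x - 1)) =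
      ∑ π : PGPlane F with ¬ π.1 ≤ infPlane F,
        ∑ p : PGPoint F with p.1 ≤ infPlane F ⊓ π.1, (pencil L p π).offDiag.card := by
    have hstar : ∀ p ∈ Finset.univ.filter (fun p : PGPoint F => p.1 ≤ infPlane F),
        (∑ π : PGPlane F with ¬ π.1 ≤ infPlane F ∧ p.1 ≤ π.1, (pencil L p π).offDiag.card) =
          x * (x - 1) := by
      intro p hp
      rw [← card_offDiag_star h.1, Finset.offDiag_card, h.card_star (by simpa using hp),
        Nat.mul_sub_one]
    have hcard := card_points_le (infPlane F)
    rw [finrank_infPlane] at hcard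
    have hsum := Finset.sum_congr rfl hstar
    rw [Finset.sum_const, hcard, smul_eq_mul] at hsum
    rw [← Finset.sum_comm' (s := Finset.univ.filter fun p : PGPoint F => p.1 ≤ infPlane F)
      (t := fun p => Finset.univ.filter fun π : PGPlane F => ¬ π.1 ≤ infPlane F ∧ p.1 ≤ π.1)
      (by simp; tauto), hsum]
    simp only [Finset.sum_range_succ, Finset.sum_range_zero, pow_zero, pow_one, zero_add]
    ring
  have hdvd : 2 * (Fintype.card F + 1) ∣
      (Fintype.card F ^ 2 + Fintype.card F + 1) * (x * (x - 1)) := by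
    rw [hcount]
    exact Finset.dvd_sum fun π hπ => h.dvd_sum_card_offDiag_pencil (by simpa using hπ)
  refine Nat.Coprime.dvd_of_dvd_mul_left (Nat.Coprime.mul_left ?_ ?_) hdvd
  · rw [Nat.coprime_two_left, show Fintype.card F ^ 2 + Fintype.card F =
      Fintype.card F * (Fintype.card F + 1) by ring]
    exact (Nat.even_mul_succ_self _).add_one
  · rw [show Fintype.card F ^ 2 + Fintype.card F + 1 =
      1 + (Fintype.card F + 1) * Fintype.card F by ring]
    simp

end CL

/-- If L is a Cameron-Liebler line class of parameter x in AG(3,q), then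
x(x-1)/2 ≡ 0 (mod q+1), equivalently x(x-1) ≡ 0 (mod 2(q+1)). -/
theorem CLAG_parameter_congruence (F : Type) [Field F] [Fintype F]
    (L : Set (CL.PGLine F)) (x : ℕ) (h : CL.IsCLAG L x) :
    (Fintype.card F + 1) ∣ x * (x - 1) / 2 ∧ 2 * (Fintype.card F + 1) ∣ x * (x - 1) := by
  exact ⟨Nat.dvd_div_of_mul_dvd h.dvd_mul_pred, h.dvd_mul_pred⟩
end

section
/- Let L be a Cameron-Liebler line class of parameter x in AG(3,q). Then for every affine plane π, the number of lines of L contained in π is divisible by q+1, and for every affine point p, the number of lines of L through p is congruent to x modulo q+1. -/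
open scoped Classical

namespace CL

section Subspaces

variable {F V : Type*} [Field F] [AddCommGroup V] [Module F V] [FiniteDimensional F V]

theorem finrank_sup_point {p U : Submodule F V} (hp : Module.finrank F p = 1) (h : ¬ p ≤ U) :
    Module.finrank F ↥(p ⊔ U) = Module.finrank F U + 1 := by
  have h1 := Submodule.finrank_sup_add_finrank_inf_eq p U
  have h2 : Module.finrank F ↥(p ⊓ U) < Module.finrank F p :=
    Submodule.finrank_lt_finrank_of_lt (inf_lt_left.2 h)
  omega

variable [Finite F]

theorem finite_submodule : Finite (Submodule F V) :=
  haveI : Finite V := Module.finite_of_finite F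
  inferInstance

/-- The finset of `k`-dimensional subspaces of `V` satisfying `P`. -/
noncomputable def subspaces (k : ℕ) (P : Submodule F V → Prop) : Finset (Submodule F V) :=
  haveI : Finite (Submodule F V) := finite_submodule
  (Set.toFinite {W : Submodule F V | Module.finrank F W = k ∧ P W}).toFinset

theorem mem_subspaces {k : ℕ} {P : Submodule F V → Prop} {W : Submodule F V} :
    W ∈ subspaces k P ↔ Module.finrank F W = k ∧ P W := by
  simp [subspaces]

theorem card_points_le_s15 (U : Submodule F V) :
    (subspaces 1 (· ≤ U)).card = ∑ i ∈ Finset.range (Module.finrank F U), Nat.card F ^ i := by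
  rw [← Projectivization.card_of_finrank F U rfl,
    Nat.card_congr (Projectivization.equivSubmodule F U), ← Nat.card_eq_finsetCard]
  refine (Nat.card_congr <| Equiv.ofBijective (fun W => ⟨W.1.map U.subtype,
    mem_subspaces.2 ⟨(Submodule.finrank_map_subtype_eq U W.1).trans W.2,
      Submodule.map_subtype_le U W.1⟩⟩) ⟨fun W₁ W₂ h => ?_, fun W => ?_⟩).symm
  · exact Subtype.ext (Submodule.map_injective_of_injective U.subtype_injective
      (Subtype.ext_iff.1 h))
  · obtain ⟨h1, h2⟩ := mem_subspaces.1 W.2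
    have hW : (W.1.comap U.subtype).map U.subtype = W.1 := by
      rw [Submodule.map_comap_subtype, inf_eq_right.2 h2]
    refine ⟨⟨W.1.comap U.subtype, ?_⟩, Subtype.ext hW⟩
    rw [← Submodule.finrank_map_subtype_eq, hW, h1]

/-- The hyperplanes above a subspace of codimension two correspond to the points of a
complement of this subspace. -/
theorem card_hyperplanes_ge {k : ℕ} (U : Submodule F V) (hU : Module.finrank F U = k)
    (hV : Module.finrank F V = k + 2) :
    (subspaces (k + 1) (U ≤ ·)).card = Nat.card F + 1 := by
  obtain ⟨C, hC⟩ := U.exists_isCompl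
  have hC2 : Module.finrank F C = 2 := by
    have := Submodule.finrank_add_eq_of_isCompl hC
    omega
  have hcard := card_points_le_s15 C
  rw [hC2] at hcard
  simp only [Finset.sum_range_succ, Finset.range_zero, Finset.sum_empty, pow_zero, pow_one,
    zero_add] at hcard
  rw [add_comm (Nat.card F), ← hcard]
  refine Finset.card_bij' (fun W _ => W ⊓ C) (fun D _ => D ⊔ U) ?_ ?_ ?_ ?_
  · intro W hW
    obtain ⟨h1, h2⟩ := mem_subspaces.1 hW
    refine mem_subspaces.2 ⟨?_, inf_le_right⟩
    have h3 := Submodule.finrank_sup_add_finrank_inf_eq W C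
    rw [(hC.codisjoint.mono_left h2).eq_top, finrank_top] at h3
    omega
  · intro D hD
    obtain ⟨h1, h2⟩ := mem_subspaces.1 hD
    refine mem_subspaces.2 ⟨?_, le_sup_right⟩
    have h3 := Submodule.finrank_sup_add_finrank_inf_eq D U
    rw [(hC.disjoint.symm.mono_left h2).eq_bot, finrank_bot] at h3
    omega
  · intro W hW
    obtain ⟨h1, h2⟩ := mem_subspaces.1 hW
    rw [sup_comm, sup_comm, inf_sup_assoc_of_le _ h2, hC.symm.sup_eq_top, inf_top_eq]
  · intro D hD
    obtain ⟨h1, h2⟩ := mem_subspaces.1 hD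
    rw [sup_inf_assoc_of_le _ h2, hC.inf_eq_bot, sup_bot_eq]

end Subspaces

theorem finrank_infPlane_s15 (F : Type) [Field F] : Module.finrank F (infPlane F) = 3 := by
  have h := LinearMap.finrank_range_add_finrank_ker
    (LinearMap.proj (3 : Fin 4) : (Fin 4 → F) →ₗ[F] F)
  rw [LinearMap.range_eq_top.2 (LinearMap.proj_surjective _)] at h
  simp at h
  change 1 + Module.finrank F (infPlane F) = 4 at h
  omega

variable {F : Type} [Field F]

/-- A subspace not contained in the plane at infinity meets it in a hyperplane. -/
theorem finrank_inf_infPlane {W : Submodule F (Fin 4 → F)} (hW : ¬ W ≤ infPlane F) :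
    Module.finrank F ↥(W ⊓ infPlane F) + 1 = Module.finrank F W := by
  have h1 := Submodule.finrank_sup_add_finrank_inf_eq W (infPlane F)
  have h2 : Module.finrank F (infPlane F) < Module.finrank F ↥(W ⊔ infPlane F) :=
    Submodule.finrank_lt_finrank_of_lt (right_lt_sup.2 hW)
  have h3 := Submodule.finrank_le (W ⊔ infPlane F)
  have h4 := finrank_infPlane_s15 F
  rw [Module.finrank_fin_fun] at h3
  omega

theorem affLine.inf_eq_iff {ℓ : PGLine F} (hℓ : affLine ℓ) {d : Submodule F (Fin 4 → F)}
    (hd : Module.finrank F d = 1) (hd' : d ≤ infPlane F) : ℓ.1 ⊓ infPlane F = d ↔ d ≤ ℓ.1 := by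
  refine ⟨fun h => h ▸ inf_le_left, fun h => ?_⟩
  have h1 := finrank_inf_infPlane hℓ
  have h2 : Module.finrank F ℓ.1 = 2 := ℓ.2
  exact (Submodule.eq_of_le_of_finrank_eq (le_inf h hd') (by omega)).symm

/-- A union of two parallel classes, one inside the subspace `U` and the other outside, is a
spread, provided that both directions lie in `U`. -/
theorem isAGSpread_switch_s15 {U d e : Submodule F (Fin 4 → F)} (hd : Module.finrank F d = 1)
    (he : Module.finrank F e = 1) (hd' : d ≤ infPlane F) (he' : e ≤ infPlane F)
    (hdU : d ≤ U) (heU : e ≤ U) :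
    IsAGSpread {ℓ : PGLine F | affLine ℓ ∧ if ℓ.1 ≤ U then d ≤ ℓ.1 else e ≤ ℓ.1} := by
  refine ⟨fun ℓ hℓ => hℓ.1, fun p hp => ?_⟩
  have hp1 : Module.finrank F p.1 = 1 := p.2
  have hfin {c : Submodule F (Fin 4 → F)} (hc : Module.finrank F c = 1)
      (hc' : c ≤ infPlane F) : Module.finrank F ↥(p.1 ⊔ c) = 2 := by
    rw [finrank_sup_point hp1 fun h => hp (h.trans hc'), hc]
  have huniq {c : Submodule F (Fin 4 → F)} (hc : Module.finrank F c = 1)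
      (hc' : c ≤ infPlane F) (ℓ : PGLine F) (h1 : p.1 ≤ ℓ.1) (h2 : c ≤ ℓ.1) :
      p.1 ⊔ c = ℓ.1 :=
    Submodule.eq_of_le_of_finrank_eq (sup_le h1 h2) ((hfin hc hc').trans ℓ.2.symm)
  by_cases hpU : p.1 ≤ U
  · refine ⟨⟨p.1 ⊔ d, hfin hd hd'⟩, ⟨⟨fun h => hp (le_sup_left.trans h), ?_⟩, le_sup_left⟩, ?_⟩
    · simp [hpU, hdU]
    · rintro ℓ ⟨⟨-, h⟩, hpℓ⟩
      split_ifs at h with hℓU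
      · exact Subtype.ext (huniq hd hd' ℓ hpℓ h).symm
      · exact absurd (huniq he he' ℓ hpℓ h ▸ sup_le hpU heU) hℓU
  · refine ⟨⟨p.1 ⊔ e, hfin he he'⟩, ⟨⟨fun h => hp (le_sup_left.trans h), ?_⟩, le_sup_left⟩, ?_⟩
    · simp [hpU]
    · rintro ℓ ⟨⟨-, h⟩, hpℓ⟩
      rw [if_neg fun h => hpU (hpℓ.trans h)] at h
      exact Subtype.ext (huniq he he' ℓ hpℓ h).symm

instance [Finite F] : Finite (PGLine F) :=
  haveI := finite_submodule (F := F) (V := Fin 4 → F)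
  inferInstanceAs (Finite {W : Submodule F (Fin 4 → F) // Module.finrank F W = 2})

namespace IsCLAG

variable {L : Finset (PGLine F)} {x : ℕ}

/-- Every point at infinity lies on exactly `x` lines of `L`. -/
theorem card_through_infinite (h : IsCLAG (L : Set (PGLine F)) x) {d : Submodule F (Fin 4 → F)}
    (hd : Module.finrank F d = 1) (hd' : d ≤ infPlane F) : {ℓ ∈ L | d ≤ ℓ.1}.card = x := by
  rw [← h.2 _ (isAGSpread_switch_s15 (U := ⊤) hd hd hd' hd' le_top le_top), ← Set.ncard_coe_finset]
  congr 1
  ext ℓ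
  have := h.1 ℓ
  simp only [Finset.coe_filter, Set.mem_inter_iff, Set.mem_ofPred_eq, Finset.mem_coe] at this ⊢
  simp
  tauto

/-- The number of lines of `L` in `U` with a given direction in `U` is the same for all such
directions. -/
theorem card_parallel_eq (h : IsCLAG (L : Set (PGLine F)) x) {U d e : Submodule F (Fin 4 → F)}
    (hd : Module.finrank F d = 1) (he : Module.finrank F e = 1) (hd' : d ≤ infPlane F)
    (he' : e ≤ infPlane F) (hdU : d ≤ U) (heU : e ≤ U) :
    {ℓ ∈ L | ℓ.1 ≤ U ∧ d ≤ ℓ.1}.card = {ℓ ∈ L | ℓ.1 ≤ U ∧ e ≤ ℓ.1}.card := by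
  have key {c : Submodule F (Fin 4 → F)} (hc : Module.finrank F c = 1) (hc' : c ≤ infPlane F)
      (hcU : c ≤ U) : {ℓ ∈ L | ℓ.1 ≤ U ∧ c ≤ ℓ.1}.card +
        {ℓ ∈ L | ¬ ℓ.1 ≤ U ∧ e ≤ ℓ.1}.card = x := by
    rw [← h.2 _ (isAGSpread_switch_s15 hc he hc' he' hcU heU), ← Finset.card_union_of_disjoint,
      ← Set.ncard_coe_finset]
    · congr 1
      ext ℓ
      have := h.1 ℓ
      simp only [Finset.coe_union, Finset.coe_filter, Set.mem_union, Set.mem_inter_iff,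
        Set.mem_ofPred_eq, Finset.mem_coe] at this ⊢
      split_ifs <;> tauto
    · exact Finset.disjoint_filter.2 fun ℓ _ h1 h2 => h2.1 h1.1
  have h1 := key hd hd' hdU
  have h2 := key he he' heU
  omega

variable [Fintype F]

theorem card_eq_sum_directions (h : IsCLAG (L : Set (PGLine F)) x)
    (U : Submodule F (Fin 4 → F)) :
    {ℓ ∈ L | ℓ.1 ≤ U}.card =
      ∑ d ∈ subspaces 1 (· ≤ U ⊓ infPlane F), {ℓ ∈ L | ℓ.1 ≤ U ∧ d ≤ ℓ.1}.card := by
  rw [Finset.card_eq_sum_card_fiberwise (f := fun ℓ => ℓ.1 ⊓ infPlane F)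
    (t := subspaces 1 (· ≤ U ⊓ infPlane F))]
  · refine Finset.sum_congr rfl fun d hd => ?_
    obtain ⟨hd1, hd2⟩ := mem_subspaces.1 hd
    rw [Finset.filter_filter]
    refine congrArg _ (Finset.filter_congr fun ℓ hℓ => ?_)
    rw [affLine.inf_eq_iff (h.1 ℓ hℓ) hd1 (hd2.trans inf_le_right)]
  · intro ℓ hℓ
    obtain ⟨h1, h2⟩ := Finset.mem_filter.1 hℓ
    have h3 := finrank_inf_infPlane (h.1 ℓ h1)
    have h4 : Module.finrank F ℓ.1 = 2 := ℓ.2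
    exact mem_subspaces.2 ⟨by dsimp only; omega, inf_le_inf_right _ h2⟩

theorem dvd_card_plane (h : IsCLAG (L : Set (PGLine F)) x) {U : Submodule F (Fin 4 → F)}
    (hU : Module.finrank F U = 3) (hU' : ¬ U ≤ infPlane F) :
    Fintype.card F + 1 ∣ {ℓ ∈ L | ℓ.1 ≤ U}.card := by
  have hr : Module.finrank F ↥(U ⊓ infPlane F) = 2 := by
    have := finrank_inf_infPlane hU'
    omega
  have hc := card_points_le_s15 (U ⊓ infPlane F)
  rw [hr, Finset.sum_range_succ, Finset.sum_range_one, pow_zero, pow_one,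
    Nat.card_eq_fintype_card, add_comm] at hc
  obtain ⟨e, he⟩ := Finset.card_pos.1 (hc.ge.trans' (Nat.succ_pos _))
  obtain ⟨he1, he2⟩ := mem_subspaces.1 he
  rw [h.card_eq_sum_directions, Finset.sum_const_nat fun d hd => ?_, hc]
  · exact dvd_mul_right _ {ℓ ∈ L | ℓ.1 ≤ U ∧ e ≤ ℓ.1}.card
  · obtain ⟨hd1, hd2⟩ := mem_subspaces.1 hd
    exact h.card_parallel_eq hd1 he1 (hd2.trans inf_le_right) (he2.trans inf_le_right)
      (hd2.trans inf_le_left) (he2.trans inf_le_left)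

theorem card_eq (h : IsCLAG (L : Set (PGLine F)) x) :
    L.card = (1 + Fintype.card F + Fintype.card F ^ 2) * x := by
  have h1 := h.card_eq_sum_directions ⊤
  simp only [le_top, true_and, Finset.filter_true, top_inf_eq] at h1
  rw [h1, Finset.sum_const_nat (m := x), card_points_le_s15, finrank_infPlane_s15]
  · simp [Finset.sum_range_succ]
  · intro d hd
    obtain ⟨hd1, hd2⟩ := mem_subspaces.1 hd
    exact h.card_through_infinite hd1 hd2

end IsCLAG

variable [Fintype F]

theorem card_planes_through {p : PGPoint F} (ℓ : PGLine F) :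
    {W ∈ subspaces 3 (p.1 ≤ ·) | ℓ.1 ≤ W}.card = if p.1 ≤ ℓ.1 then Fintype.card F + 1 else 1 := by
  split_ifs with hp
  · rw [← Nat.card_eq_fintype_card, ← card_hyperplanes_ge ℓ.1 ℓ.2 (Module.finrank_fin_fun F)]
    congr 1
    ext W
    simp only [Finset.mem_filter, mem_subspaces]
    exact ⟨fun h => ⟨h.1.1, h.2⟩, fun h => ⟨⟨h.1, hp.trans h.2⟩, h.2⟩⟩
  · have hf : Module.finrank F ↥(p.1 ⊔ ℓ.1) = 3 := by
      rw [finrank_sup_point p.2 hp, ℓ.2]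
    rw [Finset.card_eq_one]
    refine ⟨p.1 ⊔ ℓ.1, Finset.eq_singleton_iff_unique_mem.2 ⟨?_, fun W hW => ?_⟩⟩
    · simp [mem_subspaces, hf]
    · simp only [Finset.mem_filter, mem_subspaces] at hW
      exact (Submodule.eq_of_le_of_finrank_eq (sup_le hW.1.2 hW.2) (hf.trans hW.1.1.symm)).symm

theorem IsCLAG.card_point_modEq {L : Finset (PGLine F)} {x : ℕ}
    (h : IsCLAG (L : Set (PGLine F)) x) {p : PGPoint F} (hp : affPoint p) :
    {ℓ ∈ L | p.1 ≤ ℓ.1}.card ≡ x [MOD Fintype.card F + 1] := by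
  have hcount : ∑ W ∈ subspaces 3 (p.1 ≤ ·), {ℓ ∈ L | ℓ.1 ≤ W}.card =
      ∑ ℓ ∈ L, {W ∈ subspaces 3 (p.1 ≤ ·) | ℓ.1 ≤ W}.card :=
    Finset.sum_card_bipartiteAbove_eq_sum_card_bipartiteBelow (fun W (ℓ : PGLine F) => ℓ.1 ≤ W)
  have hdvd : Fintype.card F + 1 ∣ ∑ W ∈ subspaces 3 (p.1 ≤ ·), {ℓ ∈ L | ℓ.1 ≤ W}.card := by
    refine Finset.dvd_sum fun W hW => ?_
    obtain ⟨h1, h2⟩ := mem_subspaces.1 hW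
    exact h.dvd_card_plane h1 fun h => hp (h2.trans h)
  have hsplit := Finset.card_filter_add_card_filter_not (s := L) (fun ℓ => p.1 ≤ ℓ.1)
  simp only [hcount, card_planes_through, Finset.sum_ite, Finset.sum_const, smul_eq_mul,
    mul_one] at hdvd
  rw [h.card_eq] at hsplit
  rw [Nat.modEq_iff_dvd]
  obtain ⟨k, hk⟩ := hdvd
  refine ⟨k - {ℓ ∈ L | p.1 ≤ ℓ.1}.card - Fintype.card F * x, ?_⟩
  zify at hk hsplit
  push_cast
  linear_combination hk - hsplit

end CL
/-- For a Cameron-Liebler line class L of parameter x in AG(3,q): the number of lines of L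
in any affine plane is divisible by q+1, and the number of lines of L through any affine
point is congruent to x modulo q+1. -/
theorem CLAG_plane_point_counts (F : Type) [Field F] [Fintype F]
    (L : Set (CL.PGLine F)) (x : ℕ) (h : CL.IsCLAG L x) :
    (∀ π : CL.PGPlane F, π.1 ≠ CL.infPlane F →
      (Fintype.card F + 1) ∣ {ℓ ∈ L | ℓ.1 ≤ π.1}.ncard) ∧
    (∀ p : CL.PGPoint F, CL.affPoint p →
      {ℓ ∈ L | p.1 ≤ ℓ.1}.ncard ≡ x [MOD Fintype.card F + 1]) := by
  lift L to Finset (CL.PGLine F) using L.toFinite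
  have hncard (P : CL.PGLine F → Prop) :
      {ℓ ∈ (L : Set (CL.PGLine F)) | P ℓ}.ncard = {ℓ ∈ L | P ℓ}.card := by
    rw [← Set.ncard_coe_finset]
    simp
  simp only [hncard]
  refine ⟨fun π hπ => h.dvd_card_plane π.2 fun hle => hπ ?_, fun p hp => h.card_point_modEq hp⟩
  exact Submodule.eq_of_le_of_finrank_eq hle (π.2.trans (CL.finrank_infPlane_s15 F).symm)
end
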